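/- Let h: ℝ → ℝ be a continuous function with the property that for every b ∈ ℝ there exist p>0 and q>0 such that q·h(b−pR) + p·h(b+qR) → ∞ as R → ∞. Set D = {(x₁,x₂) ∈ ℝ² : x₂ > h(x₁)}. Then for every point x ∈ D there exist a neighborhood U of x in D and a constant M>0 such that every harmonic map f: Δ → D with f(0) ∈ U satisfies ‖df(0)‖ < M; i.e., the tube domain T_D is Kobayashi-hyperbolic. -/

import Mathlib

open Complex Metric Set Filter Topology

/-- The Laplacian of `u : ℂ → ℝ`, as the sum of the second directional derivatives
in the directions `1` and `I`. -/
noncomputable def laplacian (u : ℂ → ℝ) (z : ℂ) : ℝ :=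
  fderiv ℝ (fun w => fderiv ℝ u w 1) z 1 +
    fderiv ℝ (fun w => fderiv ℝ u w Complex.I) z Complex.I

/-- A real-valued function is harmonic on a set if it is `C²` there and its
Laplacian vanishes there. -/
def HarmonicOn (u : ℂ → ℝ) (s : Set ℂ) : Prop :=
  ContDiffOn ℝ 2 u s ∧ ∀ z ∈ s, laplacian u z = 0

/-- A map `f = (u, v) : ℂ → ℝ²` is a harmonic map on a set if both components
are harmonic there. -/
def HarmonicMapOn (f : ℂ → ℝ × ℝ) (s : Set ℂ) : Prop :=
  HarmonicOn (fun z => (f z).1) s ∧ HarmonicOn (fun z => (f z).2) s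

/-- Maximum principle for functions locally supported from below by moduli of
holomorphic functions. -/
theorem support_max_principle (E : ℂ → ℝ) (ρ M : ℝ) (hρ : 0 < ρ)
    (hE : ContinuousOn E (closedBall 0 ρ))
    (hs : ∀ a ∈ ball (0 : ℂ) ρ, ∃ g : ℂ → ℂ, (∀ᶠ z in 𝓝 a, DifferentiableAt ℂ g z) ∧
      ‖g a‖ = E a ∧ ∀ᶠ z in 𝓝 a, ‖g z‖ ≤ E z)
    (hb : ∀ z : ℂ, ‖z‖ = ρ → E z ≤ M) : E 0 ≤ M := by
  have hcomp : IsCompact (closedBall (0 : ℂ) ρ) := isCompact_closedBall 0 ρ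
  have h0 : (0 : ℂ) ∈ closedBall (0 : ℂ) ρ := by simp [hρ.le]
  obtain ⟨m, hm, hmax⟩ := hcomp.exists_isMaxOn ⟨0, h0⟩ hE
  have hmax' : ∀ z ∈ closedBall (0 : ℂ) ρ, E z ≤ E m := fun z hz => hmax hz
  let S : Set ℂ := closedBall (0 : ℂ) ρ ∩ E ⁻¹' {E m}
  have hSc : IsCompact S :=
    hcomp.of_isClosed_subset (hE.preimage_isClosed_of_isClosed isClosed_closedBall
      isClosed_singleton) inter_subset_left
  obtain ⟨a, haS, hamax⟩ := hSc.exists_isMaxOn ⟨m, hm, rfl⟩ continuous_norm.continuousOn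
  have hamax' : ∀ z ∈ S, ‖z‖ ≤ ‖a‖ := fun z hz => hamax hz
  have haE : E a = E m := haS.2
  have han : ‖a‖ ≤ ρ := by simpa using haS.1
  rcases han.lt_or_eq with hlt | heq
  · exfalso
    have hab : a ∈ ball (0 : ℂ) ρ := by simpa using hlt
    obtain ⟨g, hg, hga, hgE⟩ := hs a hab
    have hball : ∀ᶠ z in 𝓝 a, z ∈ ball (0 : ℂ) ρ := isOpen_ball.mem_nhds hab
    have hloc : IsLocalMax (norm ∘ g) a := by
      filter_upwards [hgE, hball] with z h1 h2
      have := hmax' z (ball_subset_closedBall h2)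
      simp only [Function.comp]
      linarith
    have hev := Complex.norm_eventually_eq_of_isLocalMax hg hloc
    have hS : ∀ᶠ z in 𝓝 a, ‖z‖ ≤ ‖a‖ := by
      filter_upwards [hev, hgE, hball] with z h1 h2 h3
      refine hamax' z ⟨ball_subset_closedBall h3, ?_⟩
      have := hmax' z (ball_subset_closedBall h3)
      simp only [mem_preimage, mem_singleton_iff]
      linarith
    have hlocid : IsLocalMax (norm ∘ (fun z : ℂ => z)) a := hS
    have h1 := Complex.eventually_eq_of_isLocalMax_norm (f := fun z : ℂ => z)
      (Eventually.of_forall fun z => differentiableAt_id) hlocid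
    have h2 : ({a} : Set ℂ) ∈ 𝓝 a := by
      filter_upwards [h1] with z hz
      exact hz
    exact (not_isOpen_singleton a) (isOpen_singleton_iff_nhds_eq_pure a |>.2
      (le_antisymm (by simpa using h2) (pure_le_nhds a)))
  · calc E 0 ≤ E m := hmax' 0 h0
      _ = E a := haE.symm
      _ ≤ M := hb a heq

theorem HarmonicOn.exists_holo {u : ℂ → ℝ} (hu : HarmonicOn u (ball 0 1)) :
    ∃ F : ℂ → ℂ, DifferentiableOn ℂ F (ball 0 1) ∧ ∀ z ∈ ball (0 : ℂ) 1, (F z).re = u z := by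
  have hh : InnerProductSpace.HarmonicOnNhd u (ball 0 1) := by
    intro z hz
    refine ⟨hu.1.contDiffAt (isOpen_ball.mem_nhds hz), ?_⟩
    filter_upwards [isOpen_ball.mem_nhds hz] with w hw
    have hcd : ContDiffAt ℝ 2 u w := hu.1.contDiffAt (isOpen_ball.mem_nhds hw)
    have hd : DifferentiableAt ℝ (fderiv ℝ u) w :=
      (hcd.fderiv_right (m := 1) (by norm_num)).differentiableAt (by norm_num)
    have h2 := hu.2 w hw
    unfold laplacian at h2
    rw [fderiv_clm_apply hd (by fun_prop), fderiv_clm_apply hd (by fun_prop)] at h2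
    simp only [InnerProductSpace.laplacian_eq_iteratedFDeriv_complexPlane,
      iteratedFDeriv_two_apply]
    simpa using h2
  obtain ⟨F, hF, hF2⟩ := hh.exists_analyticOnNhd_ball_re_eq
  exact ⟨F, hF.differentiableOn, fun z hz => hF2 hz⟩

/-- Sibony-type estimate. -/
theorem sibony_core (w₁ w₂ q : ℂ → ℂ) (Ψ : ℂ → ℝ) (C : ℝ)
    (hw₁ : DifferentiableOn ℂ w₁ (ball 0 1)) (hw₂ : DifferentiableOn ℂ w₂ (ball 0 1))
    (hq : DifferentiableOn ℂ q (ball 0 1)) (h₁0 : w₁ 0 = 0) (h₂0 : w₂ 0 = 0)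
    (hΨ : ContinuousOn Ψ (ball 0 1)) (hΨ0 : ∀ z ∈ ball (0 : ℂ) 1, 0 ≤ Ψ z ∧ Ψ z ≤ C)
    (hΨs : ∀ a ∈ ball (0 : ℂ) 1, Ψ a = 0 ∨
      (Ψ a = (q a).re + 8 * (‖w₁ a‖ ^ 2 + ‖w₂ a‖ ^ 2) ∧
        ∀ᶠ z in 𝓝 a, (q z).re + 8 * (‖w₁ z‖ ^ 2 + ‖w₂ z‖ ^ 2) ≤ Ψ z))
    (hΨn : ∀ a ∈ ball (0 : ℂ) 1, ‖w₁ a‖ ^ 2 + ‖w₂ a‖ ^ 2 < 1 →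
      Ψ a = (q a).re + 8 * (‖w₁ a‖ ^ 2 + ‖w₂ a‖ ^ 2)) :
    ‖deriv w₁ 0‖ ^ 2 + ‖deriv w₂ 0‖ ^ 2 ≤ 4 * Real.exp C := by
  classical
  have hnb : ball (0 : ℂ) 1 ∈ 𝓝 (0 : ℂ) := ball_mem_nhds 0 one_pos
  set H₁ := dslope w₁ 0 with hH₁
  set H₂ := dslope w₂ 0 with hH₂
  have hdH₁ : DifferentiableOn ℂ H₁ (ball 0 1) := (Complex.differentiableOn_dslope hnb).2 hw₁
  have hdH₂ : DifferentiableOn ℂ H₂ (ball 0 1) := (Complex.differentiableOn_dslope hnb).2 hw₂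
  have hwH₁ : ∀ z, w₁ z = z * H₁ z := fun z => by
    have := sub_smul_dslope w₁ 0 z
    simp only [sub_zero, smul_eq_mul, h₁0] at this
    exact this.symm
  have hwH₂ : ∀ z, w₂ z = z * H₂ z := fun z => by
    have := sub_smul_dslope w₂ 0 z
    simp only [sub_zero, smul_eq_mul, h₂0] at this
    exact this.symm
  set s : ℂ → ℝ := fun z => ‖w₁ z‖ ^ 2 + ‖w₂ z‖ ^ 2 with hs
  set k : ℂ → ℝ := fun z => ‖H₁ z‖ ^ 2 + ‖H₂ z‖ ^ 2 with hk
  have hsk : ∀ z, s z = ‖z‖ ^ 2 * k z := fun z => by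
    simp only [hs, hk, hwH₁ z, hwH₂ z, norm_mul]; ring
  have hs0 : ∀ z, 0 ≤ s z := fun z => by simp only [hs]; positivity
  have hk0 : ∀ z, 0 ≤ k z := fun z => by simp only [hk]; positivity
  have hball : ∀ a ∈ ball (0 : ℂ) 1, ∀ᶠ z in 𝓝 a, z ∈ ball (0 : ℂ) 1 :=
    fun a ha => isOpen_ball.mem_nhds ha
  have hsc : ∀ a ∈ ball (0 : ℂ) 1, ContinuousAt s a := fun a ha => by
    have c1 := hw₁.continuousOn.continuousAt (isOpen_ball.mem_nhds ha)
    have c2 := hw₂.continuousOn.continuousAt (isOpen_ball.mem_nhds ha)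
    exact (c1.norm.pow 2).add (c2.norm.pow 2)
  have hkc : ∀ a ∈ ball (0 : ℂ) 1, ContinuousAt k a := fun a ha => by
    have c1 := hdH₁.continuousOn.continuousAt (isOpen_ball.mem_nhds ha)
    have c2 := hdH₂.continuousOn.continuousAt (isOpen_ball.mem_nhds ha)
    exact (c1.norm.pow 2).add (c2.norm.pow 2)
  have hΨc : ∀ a ∈ ball (0 : ℂ) 1, ContinuousAt Ψ a := fun a ha =>
    hΨ.continuousAt (isOpen_ball.mem_nhds ha)
  set t : ℝ → ℝ := fun x => x * Real.exp (6 - 8 * x) with htdef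
  have htc : Continuous t := by rw [htdef]; fun_prop
  have ht4 : 1 < t (1 / 4) := by
    have := Real.add_one_le_exp (4 : ℝ)
    simp only [htdef]; norm_num; linarith
  have ht1 : ∀ x, 1 ≤ x → t x ≤ 1 := fun x hx => by
    have h1 := Real.add_one_le_exp (8 * x - 6)
    have h2 : Real.exp (8 * x - 6) * Real.exp (6 - 8 * x) = 1 := by
      rw [← Real.exp_add]; simp
    have h3 := Real.exp_pos (6 - 8 * x)
    simp only [htdef]
    nlinarith
  have ht6 : ∀ x, t x ≤ Real.exp 6 := fun x => by
    have h1 := Real.add_one_le_exp (8 * x)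
    have h2 : Real.exp (8 * x) * Real.exp (6 - 8 * x) = Real.exp 6 := by
      rw [← Real.exp_add]; congr 1; ring
    have h3 := Real.exp_pos (6 - 8 * x)
    have h4 := Real.exp_pos (8 * x)
    simp only [htdef]
    rw [← h2]
    apply mul_le_mul_of_nonneg_right _ h3.le
    by_cases hx : 0 ≤ x <;> linarith
  set E₁ : ℂ → ℝ := fun z => k z * Real.exp (6 - 8 * s z) * Real.exp (Ψ z) with hE₁
  set E₂ : ℂ → ℝ := fun z => max 1 (t (s z)) * Real.exp (Ψ z) / ‖z‖ ^ 2 with hE₂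
  set E : ℂ → ℝ := fun z => if s z < 1 / 4 then E₁ z else E₂ z with hE
  have hE₁z : ∀ z, z ≠ 0 → E₁ z = t (s z) * Real.exp (Ψ z) / ‖z‖ ^ 2 := fun z hz => by
    have : ‖z‖ ≠ 0 := norm_ne_zero_iff.2 hz
    simp only [hE₁, htdef]
    have e : s z * Real.exp (6 - 8 * s z) = ‖z‖ ^ 2 * k z * Real.exp (6 - 8 * s z) := by
      rw [← hsk z]
    rw [e]
    field_simp
  have hs00 : s 0 = 0 := by simp [hs, h₁0, h₂0]
  have hE₁ev : ∀ a ∈ ball (0 : ℂ) 1, s a ≤ 1 / 4 → E =ᶠ[𝓝 a] E₁ := by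
    intro a ha hsa
    rcases hsa.lt_or_eq with hlt | heq
    · filter_upwards [(hsc a ha).eventually_lt_const hlt] with z hz
      simp only [hE, if_pos hz]
    · have ha0 : a ≠ 0 := by rintro rfl; rw [hs00] at heq; norm_num at heq
      have hta : 1 < t (s a) := by rw [heq]; exact ht4
      filter_upwards [(htc.continuousAt.comp (hsc a ha)).eventually_const_lt hta,
        isOpen_ne.mem_nhds ha0] with z hz hz0
      simp only [Function.comp] at hz
      simp only [hE]
      split_ifs
      · rfl
      · rw [hE₁z z hz0]; simp only [hE₂]; rw [max_eq_right hz.le]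
  have hE₂ev : ∀ a ∈ ball (0 : ℂ) 1, 1 / 4 < s a → E =ᶠ[𝓝 a] E₂ := by
    intro a ha hsa
    filter_upwards [(hsc a ha).eventually_const_lt hsa] with z hz
    simp only [hE, if_neg (not_lt.2 hz.le)]
  have hcE₁ : ∀ a ∈ ball (0 : ℂ) 1, ContinuousAt E₁ a := fun a ha =>
    ((hkc a ha).mul (continuousAt_const.sub (continuousAt_const.mul (hsc a ha))).rexp).mul
      (hΨc a ha).rexp
  have hcE₂ : ∀ a ∈ ball (0 : ℂ) 1, a ≠ 0 → ContinuousAt E₂ a := fun a ha ha0 =>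
    ((continuousAt_const.max (htc.continuousAt.comp (hsc a ha))).mul (hΨc a ha).rexp).div
      (continuous_norm.continuousAt.pow 2) (pow_ne_zero 2 (norm_ne_zero_iff.2 ha0))
  have hne : ∀ a, 1 / 4 < s a → a ≠ 0 := by
    rintro a ha rfl; rw [hs00] at ha; norm_num at ha
  have hcE : ∀ a ∈ ball (0 : ℂ) 1, ContinuousAt E a := fun a ha => by
    rcases le_or_gt (s a) (1 / 4) with h | h
    · exact (hcE₁ a ha).congr (hE₁ev a ha h).symm
    · exact (hcE₂ a ha (hne a h)).congr (hE₂ev a ha h).symm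
  -- support of `E₁`
  have hsup₁ : ∀ a ∈ ball (0 : ℂ) 1, s a < 1 → ∃ g : ℂ → ℂ,
      (∀ᶠ z in 𝓝 a, DifferentiableAt ℂ g z) ∧ ‖g a‖ = E₁ a ∧ ∀ᶠ z in 𝓝 a, ‖g z‖ ≤ E₁ z := by
    intro a ha hsa
    have hform : ∀ z ∈ ball (0 : ℂ) 1, s z < 1 → E₁ z = k z * Real.exp (6 + (q z).re) := by
      intro z hz hsz
      simp only [hE₁]
      rw [hΨn z hz hsz, mul_assoc, ← Real.exp_add]
      congr 2
      simp only [hs]; ring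
    obtain ⟨c₁, c₂, hc, hca⟩ : ∃ c₁ c₂ : ℂ, (∀ b₁ b₂ : ℂ,
        ‖c₁ * b₁ + c₂ * b₂‖ ^ 2 ≤ ‖b₁‖ ^ 2 + ‖b₂‖ ^ 2) ∧
        ‖c₁ * H₁ a + c₂ * H₂ a‖ ^ 2 = ‖H₁ a‖ ^ 2 + ‖H₂ a‖ ^ 2 := by
      have hCS : ∀ c₁ c₂ : ℂ, ‖c₁‖ ^ 2 + ‖c₂‖ ^ 2 ≤ 1 → ∀ b₁ b₂ : ℂ,
          ‖c₁ * b₁ + c₂ * b₂‖ ^ 2 ≤ ‖b₁‖ ^ 2 + ‖b₂‖ ^ 2 := by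
        intro c₁ c₂ hc b₁ b₂
        have h1 : ‖c₁ * b₁ + c₂ * b₂‖ ≤ ‖c₁‖ * ‖b₁‖ + ‖c₂‖ * ‖b₂‖ := by
          rw [← norm_mul, ← norm_mul]; exact norm_add_le _ _
        have h2 := pow_le_pow_left₀ (norm_nonneg _) h1 2
        have h3 : (‖c₁‖ * ‖b₁‖ + ‖c₂‖ * ‖b₂‖) ^ 2 ≤
            (‖c₁‖ ^ 2 + ‖c₂‖ ^ 2) * (‖b₁‖ ^ 2 + ‖b₂‖ ^ 2) := by
          nlinarith [sq_nonneg (‖c₁‖ * ‖b₂‖ - ‖c₂‖ * ‖b₁‖)]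
        have h4 : (‖c₁‖ ^ 2 + ‖c₂‖ ^ 2) * (‖b₁‖ ^ 2 + ‖b₂‖ ^ 2) ≤ 1 * (‖b₁‖ ^ 2 + ‖b₂‖ ^ 2) :=
          mul_le_mul_of_nonneg_right hc (by positivity)
        linarith
      rcases eq_or_lt_of_le (hk0 a) with h0 | h0
      · refine ⟨0, 0, hCS 0 0 (by simp), ?_⟩
        simp only [hk] at h0
        rw [← h0]; simp
      · set n := Real.sqrt (k a) with hn
        have hn2 : n ^ 2 = k a := Real.sq_sqrt h0.le
        have hnpos : 0 < n := Real.sqrt_pos.2 h0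
        refine ⟨(starRingEnd ℂ) (H₁ a) / n, (starRingEnd ℂ) (H₂ a) / n, hCS _ _ ?_, ?_⟩
        · apply le_of_eq
          rw [norm_div, norm_div, RCLike.norm_conj, RCLike.norm_conj, Complex.norm_real,
            Real.norm_of_nonneg hnpos.le, div_pow, div_pow, ← add_div, hn2]
          exact div_self h0.ne'
        · have e : (starRingEnd ℂ) (H₁ a) / n * H₁ a + (starRingEnd ℂ) (H₂ a) / n * H₂ a
              = ((n : ℝ) : ℂ) := by
            have e1 : (starRingEnd ℂ) (H₁ a) * H₁ a + (starRingEnd ℂ) (H₂ a) * H₂ a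
                = ((n : ℝ) : ℂ) ^ 2 := by
              rw [Complex.conj_mul', Complex.conj_mul', ← Complex.ofReal_pow n, hn2]
              simp only [hk]; push_cast; rfl
            have hnc : ((n : ℝ) : ℂ) ≠ 0 := by exact_mod_cast hnpos.ne'
            field_simp
            linear_combination e1
          rw [e, Complex.norm_real, Real.norm_of_nonneg hnpos.le, hn2]
    have hnorm : ∀ z, ‖(c₁ * H₁ z + c₂ * H₂ z) ^ 2 * Complex.exp (6 + q z)‖ =
        ‖c₁ * H₁ z + c₂ * H₂ z‖ ^ 2 * Real.exp (6 + (q z).re) := fun z => by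
      rw [norm_mul, norm_pow, Complex.norm_exp]; simp
    refine ⟨fun z => (c₁ * H₁ z + c₂ * H₂ z) ^ 2 * Complex.exp (6 + q z), ?_, ?_, ?_⟩
    · filter_upwards [hball a ha] with z hz
      have d1 := hdH₁.differentiableAt (isOpen_ball.mem_nhds hz)
      have d2 := hdH₂.differentiableAt (isOpen_ball.mem_nhds hz)
      have d3 := hq.differentiableAt (isOpen_ball.mem_nhds hz)
      fun_prop
    · rw [hnorm, hform a ha hsa, hca]
    · filter_upwards [hball a ha, (hsc a ha).eventually_lt_const hsa] with z hz hsz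
      rw [hnorm, hform z hz hsz]
      exact mul_le_mul_of_nonneg_right (hc _ _) (Real.exp_pos _).le
  -- support of `exp Ψ / ‖z‖ ^ 2`
  have hsup₂ : ∀ a ∈ ball (0 : ℂ) 1, a ≠ 0 → ∃ g : ℂ → ℂ,
      (∀ᶠ z in 𝓝 a, DifferentiableAt ℂ g z) ∧ ‖g a‖ = Real.exp (Ψ a) / ‖a‖ ^ 2 ∧
        ∀ᶠ z in 𝓝 a, ‖g z‖ ≤ Real.exp (Ψ z) / ‖z‖ ^ 2 := by
    intro a ha ha0
    obtain ⟨l, hl, hla, hlz⟩ : ∃ l : ℂ → ℂ, (∀ z ∈ ball (0 : ℂ) 1, DifferentiableAt ℂ l z) ∧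
        (l a).re = Ψ a ∧ ∀ᶠ z in 𝓝 a, (l z).re ≤ Ψ z := by
      rcases hΨs a ha with h0 | ⟨h1, h2⟩
      · refine ⟨fun _ => 0, fun z _ => by fun_prop, by simp [h0], ?_⟩
        filter_upwards [hball a ha] with z hz
        simpa using (hΨ0 z hz).1
      · have key : ∀ b c : ℂ, (2 * (starRingEnd ℂ c) * b - (starRingEnd ℂ c) * c).re
            = ‖b‖ ^ 2 - ‖b - c‖ ^ 2 := by
          intro b c
          simp only [← Complex.normSq_eq_norm_sq, Complex.normSq_apply]
          simp
          ring
        refine ⟨fun z => q z + (8 : ℝ) * ((2 * (starRingEnd ℂ (w₁ a)) * w₁ z -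
            (starRingEnd ℂ (w₁ a)) * w₁ a) + (2 * (starRingEnd ℂ (w₂ a)) * w₂ z -
            (starRingEnd ℂ (w₂ a)) * w₂ a)), ?_, ?_, ?_⟩
        · intro z hz
          have d1 := hw₁.differentiableAt (isOpen_ball.mem_nhds hz)
          have d2 := hw₂.differentiableAt (isOpen_ball.mem_nhds hz)
          have d3 := hq.differentiableAt (isOpen_ball.mem_nhds hz)
          fun_prop
        · rw [Complex.add_re, Complex.re_ofReal_mul, Complex.add_re, key, key, h1]; simp
        · filter_upwards [h2] with z hz
          refine le_trans ?_ hz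
          rw [Complex.add_re, Complex.re_ofReal_mul, Complex.add_re, key, key]
          have p1 := sq_nonneg ‖w₁ z - w₁ a‖
          have p2 := sq_nonneg ‖w₂ z - w₂ a‖
          linarith
    have hnorm : ∀ z, ‖Complex.exp (l z) / z ^ 2‖ = Real.exp (l z).re / ‖z‖ ^ 2 := fun z => by
      rw [norm_div, norm_pow, Complex.norm_exp]
    refine ⟨fun z => Complex.exp (l z) / z ^ 2, ?_, ?_, ?_⟩
    · filter_upwards [hball a ha, isOpen_ne.mem_nhds ha0] with z hz hz0
      exact (hl z hz).cexp.div (by fun_prop) (pow_ne_zero 2 hz0)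
    · rw [hnorm, hla]
    · filter_upwards [hlz] with z hz
      rw [hnorm]
      gcongr
  have hsub : closedBall (0 : ℂ) (1 / 2) ⊆ ball 0 1 := closedBall_subset_ball (by norm_num)
  have hmain := support_max_principle E (1 / 2) (4 * Real.exp 6 * Real.exp C) (by norm_num)
    (fun a ha => (hcE a (hsub ha)).continuousWithinAt) ?_ ?_
  · have hE0 : E 0 = k 0 * Real.exp 6 * Real.exp (Ψ 0) := by
      simp only [hE, hs00, hE₁]
      norm_num
    have hk00 : k 0 = ‖deriv w₁ 0‖ ^ 2 + ‖deriv w₂ 0‖ ^ 2 := by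
      simp only [hk, hH₁, hH₂, dslope_same]
    rw [← hk00]
    have h1 : 1 ≤ Real.exp (Ψ 0) := Real.one_le_exp (hΨ0 0 (by simp)).1
    have h6 := Real.exp_pos 6
    rw [hE0] at hmain
    have h2 : k 0 * Real.exp 6 * 1 ≤ k 0 * Real.exp 6 * Real.exp (Ψ 0) :=
      mul_le_mul_of_nonneg_left h1 (mul_nonneg (hk0 0) h6.le)
    have h3 : k 0 * Real.exp 6 ≤ 4 * Real.exp C * Real.exp 6 := by linarith
    exact le_of_mul_le_mul_right h3 h6
  · intro a ha'
    have ha : a ∈ ball (0 : ℂ) 1 := hsub (ball_subset_closedBall ha')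
    rcases le_or_gt (s a) (1 / 4) with h | h
    · obtain ⟨g, g1, g2, g3⟩ := hsup₁ a ha (by linarith)
      have hev := hE₁ev a ha h
      refine ⟨g, g1, by rw [g2, hev.eq_of_nhds], ?_⟩
      filter_upwards [g3, hev] with z hz hz2
      rw [hz2]; exact hz
    · have hev := hE₂ev a ha h
      have ha0 := hne a h
      by_cases hcase : s a < 1 ∧ 1 ≤ t (s a)
      · obtain ⟨g, g1, g2, g3⟩ := hsup₁ a ha hcase.1
        refine ⟨g, g1, ?_, ?_⟩
        · rw [g2, hev.eq_of_nhds, hE₁z a ha0]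
          simp only [hE₂]; rw [max_eq_right hcase.2]
        · filter_upwards [g3, hev, isOpen_ne.mem_nhds ha0] with z hz hz2 hz0
          rw [hz2]
          refine hz.trans ?_
          rw [hE₁z z hz0]
          simp only [hE₂]
          gcongr
          exact le_max_right _ _
      · have hle : t (s a) ≤ 1 := by
          rcases lt_or_ge (s a) 1 with h1 | h1
          · by_contra hcon
            exact hcase ⟨h1, (not_le.1 hcon).le⟩
          · exact ht1 _ h1
        obtain ⟨g, g1, g2, g3⟩ := hsup₂ a ha ha0
        refine ⟨g, g1, ?_, ?_⟩
        · rw [g2, hev.eq_of_nhds]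
          simp only [hE₂]; rw [max_eq_left hle, one_mul]
        · filter_upwards [g3, hev] with z hz hz2
          rw [hz2]
          refine hz.trans ?_
          simp only [hE₂]
          gcongr
          exact le_mul_of_one_le_left (Real.exp_pos _).le (le_max_left _ _)
  · intro z hz
    have hzb : z ∈ ball (0 : ℂ) 1 := by simp [hz]; norm_num
    have hz0 : z ≠ 0 := by rintro rfl; norm_num at hz
    have h6 : 1 ≤ Real.exp 6 := Real.one_le_exp (by norm_num)
    have hle : E z ≤ max 1 (t (s z)) * Real.exp (Ψ z) / ‖z‖ ^ 2 := by
      simp only [hE]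
      split_ifs
      · rw [hE₁z z hz0]; gcongr; exact le_max_right _ _
      · exact le_rfl
    refine hle.trans ?_
    have h7 : max 1 (t (s z)) ≤ Real.exp 6 := max_le h6 (ht6 _)
    have h8 : Real.exp (Ψ z) ≤ Real.exp C := Real.exp_le_exp.2 (hΨ0 z hzb).2
    have h9 : max 1 (t (s z)) * Real.exp (Ψ z) ≤ Real.exp 6 * Real.exp C := by gcongr
    rw [hz]
    rw [div_le_iff₀ (by norm_num)]
    linarith

theorem epigraph_geometry (h : ℝ → ℝ) (hcont : Continuous h) (x : ℝ × ℝ) (hx : h x.1 < x.2)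
    (hgrowth : ∃ p > (0 : ℝ), ∃ q > (0 : ℝ),
      Tendsto (fun R : ℝ => q * h (x.1 - p * R) + p * h (x.1 + q * R)) atTop atTop) :
    ∃ (α β κ δ C : ℝ) (Q Φ : ℝ × ℝ → ℝ), 0 < κ ∧ 0 < δ ∧
      (∀ y, Q y = α + β * y.1 - y.2 + κ * ((y.1 - x.1) ^ 2 + (y.2 - x.2) ^ 2)) ∧
      ContinuousOn Φ {y : ℝ × ℝ | h y.1 < y.2} ∧
      (∀ y : ℝ × ℝ, h y.1 < y.2 → 0 ≤ Φ y ∧ Φ y ≤ C) ∧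
      (∀ y : ℝ × ℝ, Φ y = 0 ∨ (Φ y = Q y ∧ ∀ᶠ z in 𝓝 y, Q z ≤ Φ z)) ∧
      (∀ y : ℝ × ℝ, |y.1 - x.1| < 2 * δ → |y.2 - x.2| < 2 * δ → Φ y = Q y) := by
  obtain ⟨p, hp, q, hq, ht⟩ := hgrowth
  obtain ⟨R, hR, hR0⟩ := ((ht.eventually_gt_atTop ((p + q) * (x.2 + 2))).and
    (eventually_gt_atTop 0)).exists
  set a₁ := x.1 - p * R with ha₁
  set a₂ := x.1 + q * R with ha₂
  have h1 : a₁ < x.1 := by have := mul_pos hp hR0; linarith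
  have h2 : x.1 < a₂ := by have := mul_pos hq hR0; linarith
  set β := (h a₂ - h a₁) / (a₂ - a₁) with hβ
  set α := h a₁ - 1 - β * a₁ with hα
  have hne : a₂ - a₁ ≠ 0 := by linarith
  have e1 : α + β * a₁ = h a₁ - 1 := by rw [hα]; ring
  have e2 : α + β * a₂ = h a₂ - 1 := by
    have : β * (a₂ - a₁) = h a₂ - h a₁ := by rw [hβ]; field_simp
    linarith
  have e3 : x.2 + 1 < α + β * x.1 := by
    have : (p + q) * (α + β * x.1) = q * (α + β * a₁) + p * (α + β * a₂) := by
      rw [ha₁, ha₂]; ring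
    rw [e1, e2] at this
    by_contra hcon
    push Not at hcon
    have := mul_le_mul_of_nonneg_left hcon (add_pos hp hq).le
    nlinarith
  set T := max (max (h a₁) (h a₂)) x.2 + 1 with hT
  have hT1 : h a₁ + 1 ≤ T := by rw [hT]; gcongr; exact (le_max_left _ _).trans (le_max_left _ _)
  have hT2 : h a₂ + 1 ≤ T := by rw [hT]; gcongr; exact (le_max_right _ _).trans (le_max_left _ _)
  have hT3 : x.2 + 1 ≤ T := by rw [hT]; gcongr; exact le_max_right _ _
  obtain ⟨m, hm⟩ := (isCompact_Icc (a := a₁) (b := a₂)).bddBelow_image hcont.continuousOn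
  have hm' : ∀ t ∈ Icc a₁ a₂, m ≤ h t := fun t ht => hm ⟨t, ht, rfl⟩
  have hK : IsCompact (Icc a₁ a₂ ×ˢ Icc m T) := isCompact_Icc.prod isCompact_Icc
  obtain ⟨N, hN⟩ := hK.bddAbove_image (f := fun y : ℝ × ℝ => (y.1 - x.1) ^ 2 + (y.2 - x.2) ^ 2)
    (by fun_prop)
  have hN' : ∀ y ∈ Icc a₁ a₂ ×ˢ Icc m T, (y.1 - x.1) ^ 2 + (y.2 - x.2) ^ 2 ≤ N :=
    fun y hy => hN ⟨y, hy, rfl⟩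
  obtain ⟨κ, hκ, hκN⟩ : ∃ κ > 0, κ * N ≤ 1 / 2 := by
    refine ⟨1 / (2 * (|N| + 1)), by positivity, ?_⟩
    rw [div_mul_eq_mul_div, div_le_div_iff₀ (by positivity) (by norm_num)]
    have := le_abs_self N
    linarith
  set Q : ℝ × ℝ → ℝ := fun y => α + β * y.1 - y.2 + κ * ((y.1 - x.1) ^ 2 + (y.2 - x.2) ^ 2) with hQ
  have hQc : Continuous Q := by rw [hQ]; fun_prop
  obtain ⟨C, hC⟩ := hK.bddAbove_image (f := Q) hQc.continuousOn
  have hC' : ∀ y ∈ Icc a₁ a₂ ×ˢ Icc m T, Q y ≤ C := fun y hy => hC ⟨y, hy, rfl⟩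
  set B : Set (ℝ × ℝ) := Ioo a₁ a₂ ×ˢ Iio T with hB
  have hBo : IsOpen B := isOpen_Ioo.prod isOpen_Iio
  have hclosedB : IsClosed (Icc a₁ a₂ ×ˢ Iic T) := isClosed_Icc.prod isClosed_Iic
  have hline : ∀ t ∈ Icc a₁ a₂, α + β * t ≤ T - 2 := by
    intro t ht
    rcases le_total 0 β with hb | hb
    · have := mul_le_mul_of_nonneg_left ht.2 hb
      linarith
    · have := mul_le_mul_of_nonpos_left ht.1 hb
      linarith
  have hbd : ∀ y : ℝ × ℝ, h y.1 < y.2 → y ∉ B → y ∈ Icc a₁ a₂ ×ˢ Iic T → Q y < 0 := by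
    rintro ⟨y1, y2⟩ hyD hyB ⟨hy1, hy2⟩
    simp only [mem_Iic] at hyD hy1 hy2
    have hn := hN' (y1, y2) ⟨hy1, (hm' _ hy1).trans hyD.le, hy2⟩
    have hn2 := mul_le_mul_of_nonneg_left hn hκ.le
    simp only [hQ]
    simp only at hn2
    have hl := hline y1 hy1
    have : y1 = a₁ ∨ y1 = a₂ ∨ y2 = T := by
      by_contra hcon
      push Not at hcon
      exact hyB ⟨⟨lt_of_le_of_ne hy1.1 (Ne.symm hcon.1), lt_of_le_of_ne hy1.2 hcon.2.1⟩,
        lt_of_le_of_ne hy2 hcon.2.2⟩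
    rcases this with rfl | rfl | rfl <;> linarith
  classical
  set Φ : ℝ × ℝ → ℝ := fun y => if y ∈ B then max (Q y) 0 else 0 with hΦ
  have hΦB : ∀ y ∈ B, Φ y = max (Q y) 0 := fun y hy => by simp only [hΦ, if_pos hy]
  have hΦn : ∀ y, y ∉ B → Φ y = 0 := fun y hy => by simp only [hΦ, if_neg hy]
  have hΦev : ∀ y ∈ B, Φ =ᶠ[𝓝 y] fun y => max (Q y) 0 := by
    intro y hy
    filter_upwards [hBo.mem_nhds hy] with z hz using hΦB z hz
  have hxB : x ∈ B := ⟨⟨h1, h2⟩, by simp only [mem_Iio]; linarith⟩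
  have hQx : 0 < Q x := by simp only [hQ]; nlinarith
  have hopen : ∀ᶠ y in 𝓝 x, y ∈ B ∧ 0 < Q y :=
    (hBo.eventually_mem hxB).and (hQc.continuousAt.eventually_const_lt hQx)
  obtain ⟨r, hr, hrb⟩ := Metric.eventually_nhds_iff.1 hopen
  refine ⟨α, β, κ, r / 2, max C 0, Q, Φ, hκ, by positivity, fun y => rfl, ?_, ?_, ?_, ?_⟩
  · intro y hyD
    by_cases hy : y ∈ B
    · exact ((hQc.max continuous_const).continuousAt.congr (hΦev y hy).symm).continuousWithinAt
    · have : Φ =ᶠ[𝓝 y] fun _ => 0 := by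
        by_cases hy2 : y ∈ Icc a₁ a₂ ×ˢ Iic T
        · have hneg := hbd y hyD hy hy2
          filter_upwards [hQc.continuousAt.eventually_lt_const hneg] with z hz
          by_cases hzB : z ∈ B
          · rw [hΦB z hzB, max_eq_right hz.le]
          · exact hΦn z hzB
        · filter_upwards [hclosedB.isOpen_compl.mem_nhds hy2] with z hz
          apply hΦn
          intro hzB
          exact hz ⟨Ioo_subset_Icc_self hzB.1, mem_Iic.2 (le_of_lt (mem_Iio.1 hzB.2))⟩
      exact (continuousAt_const.congr this.symm).continuousWithinAt
  · intro y hyD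
    by_cases hy : y ∈ B
    · rw [hΦB y hy]
      refine ⟨le_max_right _ _, max_le_max ?_ le_rfl⟩
      have hi := Ioo_subset_Icc_self hy.1
      exact hC' y ⟨hi, (hm' _ hi).trans hyD.le, le_of_lt hy.2⟩
    · rw [hΦn y hy]; exact ⟨le_rfl, le_max_right _ _⟩
  · intro y
    by_cases hy : y ∈ B
    · rcases le_total (Q y) 0 with hq0 | hq0
      · left; rw [hΦB y hy, max_eq_right hq0]
      · right
        refine ⟨by rw [hΦB y hy, max_eq_left hq0], ?_⟩
        filter_upwards [hΦev y hy] with z hz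
        rw [hz]; exact le_max_left _ _
    · left; exact hΦn y hy
  · intro y hy1 hy2
    have hd : dist y x < r := by
      rw [Prod.dist_eq, Real.dist_eq, Real.dist_eq]
      exact max_lt (by linarith) (by linarith)
    obtain ⟨hyB, hyQ⟩ := hrb hd
    rw [hΦB y hyB, max_eq_left hyQ.le]

/-- If `h : ℝ → ℝ` is continuous and for every `b` there are `p, q > 0` with
`q·h(b - pR) + p·h(b + qR) → ∞` as `R → ∞`, then the epigraph domain
`D = {x₂ > h(x₁)}` satisfies the harmonic-map derivative bound; i.e. the tube
domain `T_D` is Kobayashi-hyperbolic. -/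
theorem epigraph_hyperbolic (h : ℝ → ℝ) (hcont : Continuous h)
    (hgrowth : ∀ b : ℝ, ∃ p > (0 : ℝ), ∃ q > (0 : ℝ),
      Tendsto (fun R : ℝ => q * h (b - p * R) + p * h (b + q * R)) atTop atTop)
    (x : ℝ × ℝ) (hx : x ∈ {y : ℝ × ℝ | h y.1 < y.2}) :
    ∃ U ⊆ {y : ℝ × ℝ | h y.1 < y.2}, U ∈ 𝓝 x ∧ ∃ M > (0 : ℝ),
      ∀ f : ℂ → ℝ × ℝ, HarmonicMapOn f (ball (0 : ℂ) 1) →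
        MapsTo f (ball (0 : ℂ) 1) {y : ℝ × ℝ | h y.1 < y.2} → f 0 ∈ U →
          ‖fderiv ℝ f 0‖ < M := by
  obtain ⟨α, β, κ, δ, C, Q, Φ, hκ, hδ, hQ, hΦc, hΦb, hΦs, hΦn⟩ :=
    epigraph_geometry h hcont x hx (hgrowth x.1)
  have hDo : IsOpen {y : ℝ × ℝ | h y.1 < y.2} :=
    isOpen_lt (hcont.comp continuous_fst) continuous_snd
  set A := 16 / (κ * δ ^ 2) with hA
  have hA0 : 0 < A := by positivity
  have hAκ : A * κ * δ ^ 2 = 16 := by rw [hA]; field_simp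
  refine ⟨ball x δ ∩ {y : ℝ × ℝ | h y.1 < y.2}, inter_subset_right,
    inter_mem (ball_mem_nhds x hδ) (hDo.mem_nhds hx), 4 * δ ^ 2 * Real.exp (A * C) + 1,
    by positivity, ?_⟩
  intro f hf hfD hf0
  obtain ⟨F₁, hF₁, hre₁⟩ := hf.1.exists_holo
  obtain ⟨F₂, hF₂, hre₂⟩ := hf.2.exists_holo
  have h0b : (0 : ℂ) ∈ ball (0 : ℂ) 1 := by simp
  have hnb : ball (0 : ℂ) 1 ∈ 𝓝 (0 : ℂ) := isOpen_ball.mem_nhds h0b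
  have hfc : ContinuousOn f (ball (0 : ℂ) 1) :=
    (hf.1.1.continuousOn.prodMk hf.2.1.continuousOn)
  have hdist := hf0.1
  rw [mem_ball, Prod.dist_eq, max_lt_iff, Real.dist_eq, Real.dist_eq] at hdist
  set W₁ : ℂ → ℂ := fun z => F₁ z - F₁ 0 with hW₁
  set W₂ : ℂ → ℂ := fun z => F₂ z - F₂ 0 with hW₂
  have hdW₁ : DifferentiableOn ℂ W₁ (ball 0 1) := hF₁.sub_const _
  have hdW₂ : DifferentiableOn ℂ W₂ (ball 0 1) := hF₂.sub_const _
  have hδc : ((δ : ℝ) : ℂ) ≠ 0 := by exact_mod_cast hδ.ne'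
  have hwn : ∀ c : ℂ, ‖c / (δ : ℂ)‖ = ‖c‖ / δ := fun c => by
    rw [norm_div, Complex.norm_real, Real.norm_of_nonneg hδ.le]
  have hu₁ : ∀ z ∈ ball (0 : ℂ) 1, (f z).1 = (f 0).1 + (W₁ z).re := fun z hz => by
    simp only [hW₁, Complex.sub_re, hre₁ z hz, hre₁ 0 h0b]; ring
  have hu₂ : ∀ z ∈ ball (0 : ℂ) 1, (f z).2 = (f 0).2 + (W₂ z).re := fun z hz => by
    simp only [hW₂, Complex.sub_re, hre₂ z hz, hre₂ 0 h0b]; ring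
  set d₁ : ℝ := (f 0).1 - x.1 with hd₁
  set d₂ : ℝ := (f 0).2 - x.2 with hd₂
  set q : ℂ → ℂ := fun z => (A : ℝ) * (((α + β * (f 0).1 - (f 0).2 + κ * (d₁ ^ 2 + d₂ ^ 2) : ℝ) : ℂ)
    + (β : ℝ) * W₁ z - W₂ z + (κ : ℝ) * (((2 * d₁ : ℝ) : ℂ) * W₁ z + ((2 * d₂ : ℝ) : ℂ) * W₂ z
      + ((1 / 2 : ℝ) : ℂ) * (W₁ z * W₁ z + W₂ z * W₂ z))) with hqdef
  have hdq : DifferentiableOn ℂ q (ball 0 1) := by rw [hqdef]; fun_prop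
  have hQq : ∀ z ∈ ball (0 : ℂ) 1, A * Q (f z) =
      (q z).re + 8 * (‖W₁ z / δ‖ ^ 2 + ‖W₂ z / δ‖ ^ 2) := by
    intro z hz
    rw [hwn, hwn, div_pow, div_pow, hQ, hu₁ z hz, hu₂ z hz, ← Complex.normSq_eq_norm_sq,
      ← Complex.normSq_eq_norm_sq, Complex.normSq_apply, Complex.normSq_apply]
    simp only [hqdef, Complex.re_ofReal_mul, Complex.add_re, Complex.sub_re, Complex.ofReal_re,
      Complex.mul_re (W₁ z), Complex.mul_re (W₂ z)]
    have e8 : ∀ r : ℝ, 8 * (r / δ ^ 2) = A * κ / 2 * r := by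
      intro r
      have : A * κ = 16 / δ ^ 2 := by rw [← hAκ]; field_simp
      rw [this]; ring
    rw [mul_add 8, e8, e8]
    have r1 : (f 0).1 = d₁ + x.1 := by rw [hd₁]; ring
    have r2 : (f 0).2 = d₂ + x.2 := by rw [hd₂]; ring
    rw [r1, r2]
    ring
  have hcore := sibony_core (fun z => W₁ z / δ) (fun z => W₂ z / δ) q (fun z => A * Φ (f z)) (A * C)
    (hdW₁.div_const _) (hdW₂.div_const _) hdq (by simp [hW₁]) (by simp [hW₂])
    (continuousOn_const.mul (hΦc.comp hfc hfD))
    (fun z hz => ⟨mul_nonneg hA0.le (hΦb _ (hfD hz)).1,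
      mul_le_mul_of_nonneg_left (hΦb _ (hfD hz)).2 hA0.le⟩) ?_ ?_
  · have dW₁ : DifferentiableAt ℂ F₁ 0 := hF₁.differentiableAt hnb
    have dW₂ : DifferentiableAt ℂ F₂ 0 := hF₂.differentiableAt hnb
    have e1 : deriv (fun z => W₁ z / δ) 0 = deriv F₁ 0 / δ := by
      rw [deriv_div_const]; simp only [hW₁, deriv_sub_const]
    have e2 : deriv (fun z => W₂ z / δ) 0 = deriv F₂ 0 / δ := by
      rw [deriv_div_const]; simp only [hW₂, deriv_sub_const]
    rw [e1, e2, hwn, hwn, div_pow, div_pow, ← add_div, div_le_iff₀ (by positivity)] at hcore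
    have hre : ∀ (F : ℂ → ℂ), DifferentiableAt ℂ F 0 → ∃ L : ℂ →L[ℝ] ℝ,
        HasFDerivAt (fun z => (F z).re) L 0 ∧ ‖L‖ ≤ ‖deriv F 0‖ := by
      intro F dF
      have h1 := dF.hasFDerivAt.restrictScalars ℝ
      refine ⟨_, Complex.reCLM.hasFDerivAt.comp (0 : ℂ) h1, ?_⟩
      refine ContinuousLinearMap.opNorm_le_bound _ (norm_nonneg _) fun v => ?_
      have h2 : fderiv ℂ F 0 v = v * deriv F 0 := by
        rw [← fderiv_apply_one_eq_deriv]
        have := (fderiv ℂ F 0).map_smul v 1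
        simpa using this
      simp only [ContinuousLinearMap.comp_apply, Complex.reCLM_apply,
        ContinuousLinearMap.coe_restrictScalars', h2]
      rw [Real.norm_eq_abs, mul_comm ‖deriv F 0‖, ← norm_mul]
      exact Complex.abs_re_le_norm _
    obtain ⟨L₁, hL₁, hn₁⟩ := hre F₁ dW₁
    obtain ⟨L₂, hL₂, hn₂⟩ := hre F₂ dW₂
    have hfd : HasFDerivAt f (L₁.prod L₂) 0 := by
      refine (hL₁.prodMk hL₂).congr_of_eventuallyEq ?_
      filter_upwards [hnb] with z hz
      rw [hre₁ z hz, hre₂ z hz]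
    rw [hfd.fderiv, ContinuousLinearMap.opNorm_prod, Prod.norm_mk]
    have hK : 4 * Real.exp (A * C) * δ ^ 2 = 4 * δ ^ 2 * Real.exp (A * C) := by ring
    rw [hK] at hcore
    apply max_lt
    · nlinarith [sq_nonneg (‖deriv F₁ 0‖ - 1), sq_nonneg ‖deriv F₂ 0‖, sq_nonneg (‖deriv F₁ 0‖)]
    · nlinarith [sq_nonneg (‖deriv F₂ 0‖ - 1), sq_nonneg ‖deriv F₁ 0‖, sq_nonneg (‖deriv F₂ 0‖)]
  · intro a ha
    rcases hΦs (f a) with h0 | ⟨h1, h2⟩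
    · left; simp only [h0, mul_zero]
    · right
      refine ⟨by simp only [h1]; exact hQq a ha, ?_⟩
      have hca : ContinuousAt f a := hfc.continuousAt (isOpen_ball.mem_nhds ha)
      filter_upwards [hca.eventually h2, isOpen_ball.mem_nhds ha] with z hz hzb
      rw [← hQq z hzb]
      exact mul_le_mul_of_nonneg_left hz hA0.le
  · intro a ha hsa
    rw [← hQq a ha]
    rw [hwn, hwn] at hsa
    have hb : ∀ c : ℂ, (‖c‖ / δ) ^ 2 < 1 → |c.re| < δ := by
      intro c hc
      have h1 : ‖c‖ / δ < 1 := by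
        by_contra hcon
        push Not at hcon
        nlinarith
      rw [div_lt_one hδ] at h1
      exact (Complex.abs_re_le_norm c).trans_lt h1
    have b1 := hb (W₁ a) (by nlinarith [sq_nonneg (‖W₂ a‖ / δ)])
    have b2 := hb (W₂ a) (by nlinarith [sq_nonneg (‖W₁ a‖ / δ)])
    rw [hΦn]
    · rw [hu₁ a ha, show (f 0).1 + (W₁ a).re - x.1 = d₁ + (W₁ a).re by rw [hd₁]; ring]
      exact (abs_add_le _ _).trans_lt (by linarith [hdist.1])
    · rw [hu₂ a ha, show (f 0).2 + (W₂ a).re - x.2 = d₂ + (W₂ a).re by rw [hd₂]; ring]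
      exact (abs_add_le _ _).trans_lt (by linarith [hdist.2])
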